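/- Fix b > 0 and m, ρ ∈ ℝ, define H, C and v_b as follows: H(y) := (r/(r+q))·(Zbar(y) + m/q), C := (H(b) + ρ)/Zqr(b), v_b(x) := C·Zqr(b−x) − H(b−x). Assume W(0+) > 0 (the bounded-variation case). Then v_b is twice differentiable on ℝ∖{b} with v_b″(x) = −(rq/(r+q))·W(b−x) + C·(q/(r+q))·(φ²·J(b−x) − r·φ·W(b−x)) for x ≠ b; the one-sided limits satisfy lim_{x↓b} v_b″(x) = C·(q/(r+q))·φ² and lim_{x↑b} v_b″(x) = −(rq/(r+q))·W(0+) + C·(q/(r+q))·φ·(φ − r·W(0+)), so that lim_{x↓b} v_b″(x) − lim_{x↑b} v_b″(x) = (rq/(r+q))·W(0+)·(1 + C·φ); consequently the two limits coincide (i.e., v_b is C² at b) if and only if C = −1/φ. -/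

import Mathlib

open MeasureTheory Real Set Filter Topology

/-- `Wbar x = ∫_0^x W(z) dz`. -/
noncomputable def Wbar (W : ℝ → ℝ) (x : ℝ) : ℝ := ∫ z in (0:ℝ)..x, W z

/-- `Zq x = 1 + q · Wbar x`. -/
noncomputable def Zq (q : ℝ) (W : ℝ → ℝ) (x : ℝ) : ℝ := 1 + q * Wbar W x

/-- `Zbar x = ∫_0^x Zq(z) dz`. -/
noncomputable def Zbar (q : ℝ) (W : ℝ → ℝ) (x : ℝ) : ℝ := ∫ z in (0:ℝ)..x, Zq q W z

/-- `J x = e^{φx} (1 − r ∫_0^x e^{−φz} W(z) dz)`. -/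
noncomputable def Jfun (r φ : ℝ) (W : ℝ → ℝ) (x : ℝ) : ℝ :=
  Real.exp (φ * x) * (1 - r * ∫ z in (0:ℝ)..x, Real.exp (-φ * z) * W z)

/-- `Zqr x = (r/(r+q)) Zq x + (q/(r+q)) J x`. -/
noncomputable def Zqr (q r φ : ℝ) (W : ℝ → ℝ) (x : ℝ) : ℝ :=
  (r / (r + q)) * Zq q W x + (q / (r + q)) * Jfun r φ W x

section ScaleFunction

variable {φ : ℝ} {W : ℝ → ℝ}

theorem integrable_exp_mul_of_integrableOn_Ioi (hWneg : ∀ x < (0:ℝ), W x = 0)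
    (hWint : IntegrableOn (fun z => Real.exp (-φ * z) * W z) (Ioi 0)) :
    Integrable (fun z => Real.exp (-φ * z) * W z) := by
  have hneg : IntegrableOn (fun z => Real.exp (-φ * z) * W z) (Iio 0) :=
    integrableOn_zero.congr_fun (fun z hz => by simp [hWneg z hz]) measurableSet_Iio
  rw [← integrableOn_univ, ← Iic_union_Ioi (a := (0:ℝ))]
  exact ((integrableOn_Iic_iff_integrableOn_Iio).2 hneg).union hWint

theorem intervalIntegrable_of_integrable_exp_mul
    (hInt : Integrable (fun z => Real.exp (-φ * z) * W z)) (a b : ℝ) :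
    IntervalIntegrable W volume a b := by
  have h := (hInt.intervalIntegrable (a := a) (b := b)).continuousOn_mul
    (g := fun z => Real.exp (φ * z)) (by fun_prop)
  refine h.congr (fun z _ => ?_)
  rw [← mul_assoc, ← Real.exp_add]
  simp

theorem continuousOn_compl_zero (hWneg : ∀ x < (0:ℝ), W x = 0)
    (hWcont : ContinuousOn W (Ioi 0)) : ContinuousOn W {0}ᶜ := by
  intro x hx
  refine ContinuousAt.continuousWithinAt ?_
  rcases lt_or_gt_of_ne hx with h | h
  · refine continuousAt_const.congr (f := fun _ => (0:ℝ)) ?_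
    filter_upwards [Iio_mem_nhds h] with z hz using (hWneg z hz).symm
  · exact hWcont.continuousAt (Ioi_mem_nhds h)

theorem hasDerivAt_integral_of_continuousOn_compl_zero {f : ℝ → ℝ}
    (hInt : ∀ a b : ℝ, IntervalIntegrable f volume a b) (hf : ContinuousOn f {0}ᶜ)
    {y : ℝ} (hy : y ≠ 0) : HasDerivAt (fun x => ∫ z in (0:ℝ)..x, f z) (f y) y :=
  intervalIntegral.integral_hasDerivAt_right (hInt 0 y)
    (hf.stronglyMeasurableAtFilter isOpen_compl_singleton y hy)
    (hf.continuousAt (isOpen_compl_singleton.mem_nhds hy))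

theorem continuous_Wbar (hInt : Integrable (fun z => Real.exp (-φ * z) * W z)) :
    Continuous (Wbar W) :=
  intervalIntegral.continuous_primitive (intervalIntegrable_of_integrable_exp_mul hInt) 0

theorem continuous_Zq (q : ℝ) (hInt : Integrable (fun z => Real.exp (-φ * z) * W z)) :
    Continuous (Zq q W) :=
  continuous_const.add (continuous_const.mul (continuous_Wbar hInt))

theorem continuous_Jfun (r : ℝ) (hInt : Integrable (fun z => Real.exp (-φ * z) * W z)) :
    Continuous (Jfun r φ W) := by
  have h := intervalIntegral.continuous_primitive
    (fun a b => hInt.intervalIntegrable (a := a) (b := b)) 0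
  unfold Jfun
  fun_prop

theorem hasDerivAt_Zbar (q : ℝ) (hInt : Integrable (fun z => Real.exp (-φ * z) * W z)) (y : ℝ) :
    HasDerivAt (Zbar q W) (Zq q W y) y :=
  (continuous_Zq q hInt).integral_hasStrictDerivAt 0 y |>.hasDerivAt

theorem hasDerivAt_Zq (q : ℝ) (hInt : Integrable (fun z => Real.exp (-φ * z) * W z))
    (hW : ContinuousOn W {0}ᶜ) {y : ℝ} (hy : y ≠ 0) :
    HasDerivAt (Zq q W) (q * W y) y :=
  ((hasDerivAt_integral_of_continuousOn_compl_zero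
    (intervalIntegrable_of_integrable_exp_mul hInt) hW hy).const_mul q).const_add 1

theorem hasDerivAt_Jfun (r : ℝ) (hInt : Integrable (fun z => Real.exp (-φ * z) * W z))
    (hW : ContinuousOn W {0}ᶜ) {y : ℝ} (hy : y ≠ 0) :
    HasDerivAt (Jfun r φ W) (φ * Jfun r φ W y - r * W y) y := by
  have hexp : HasDerivAt (fun x => Real.exp (φ * x)) (Real.exp (φ * y) * φ) y := by
    simpa using ((hasDerivAt_id y).const_mul φ).exp
  have hI := hasDerivAt_integral_of_continuousOn_compl_zero
    (f := fun z => Real.exp (-φ * z) * W z) (fun a b => hInt.intervalIntegrable)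
    (by fun_prop) hy
  refine (hexp.mul ((hI.const_mul r).const_sub 1)).congr_deriv ?_
  have hcancel : Real.exp (φ * y) * Real.exp (-φ * y) = 1 := by
    rw [← Real.exp_add]; simp
  unfold Jfun
  linear_combination (-r * W y) * hcancel

/-- The jump of `W` at `0` cancels in `Zqr`, which is differentiable on the whole line. -/
theorem hasDerivAt_Zqr (q r : ℝ) (hInt : Integrable (fun z => Real.exp (-φ * z) * W z))
    (hW : ContinuousOn W {0}ᶜ) (y : ℝ) :
    HasDerivAt (Zqr q r φ W) (q / (r + q) * (φ * Jfun r φ W y)) y := by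
  have hJ := continuous_Jfun r hInt
  have hZ := continuous_Zq q hInt
  have hne : ∀ y : ℝ, y ≠ 0 →
      HasDerivAt (Zqr q r φ W) (q / (r + q) * (φ * Jfun r φ W y)) y := fun y hy => by
    refine (((hasDerivAt_Zq q hInt hW hy).const_mul (r / (r + q))).add
      ((hasDerivAt_Jfun r hInt hW hy).const_mul (q / (r + q)))).congr_deriv ?_
    ring
  rcases eq_or_ne y 0 with rfl | hy
  · refine hasDerivAt_of_hasDerivAt_of_ne (g := fun y => q / (r + q) * (φ * Jfun r φ W y))
      (fun y hy => hne y hy) ?_ ?_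
    · unfold Zqr
      fun_prop
    · fun_prop
  · exact hne y hy

end ScaleFunction

/-- bounded-variation case, W(0+) > 0: v_b is twice differentiable off b with
v_b″(x) = −(rq/(r+q))·W(b−x) + C·(q/(r+q))·(φ²·J(b−x) − rφ·W(b−x)); the one-sided limits of v_b″
at b are C·(q/(r+q))·φ² (from above) and −(rq/(r+q))·W(0+) + C·(q/(r+q))·φ·(φ − r·W(0+))
(from below), their difference is (rq/(r+q))·W(0+)·(1 + Cφ), and they coincide iff C = −1/φ. -/
theorem vb_C2_iff_smooth_fit
    (q r φ : ℝ) (W : ℝ → ℝ)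
    (hq : 0 < q) (hr : 0 < r) (hφ : 0 < φ)
    (hWneg : ∀ x < (0:ℝ), W x = 0)
    (hWnn : ∀ x : ℝ, 0 ≤ W x)
    (hWcont : ContinuousOn W (Set.Ioi 0))
    (hWmono : StrictMonoOn W (Set.Ioi 0))
    (W0 : ℝ)
    (hW0 : Filter.Tendsto W (nhdsWithin 0 (Set.Ioi 0)) (nhds W0))
    (hWint : MeasureTheory.IntegrableOn (fun z => Real.exp (-φ * z) * W z) (Set.Ioi 0))
    (hWlap : r * ∫ z in Set.Ioi (0:ℝ), Real.exp (-φ * z) * W z = 1)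
    (hW0pos : 0 < W0)
    (b : ℝ) (hb : 0 < b) (m ρ : ℝ)
    (H : ℝ → ℝ) (hH : ∀ y : ℝ, H y = r / (r + q) * (Zbar q W y + m / q))
    (C : ℝ) (hC : C = (H b + ρ) / Zqr q r φ W b)
    (vb : ℝ → ℝ) (hvb : ∀ x : ℝ, vb x = C * Zqr q r φ W (b - x) - H (b - x))
    (D : ℝ → ℝ)
    (hD : ∀ x : ℝ, D x = r / (r + q) * Zq q W (b - x) - C * (q / (r + q)) * φ * Jfun r φ W (b - x))
    (E : ℝ → ℝ)
    (hE : ∀ x : ℝ, E x = -(r * q / (r + q)) * W (b - x) +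
      C * (q / (r + q)) * (φ ^ 2 * Jfun r φ W (b - x) - r * φ * W (b - x)))
    : (∀ x : ℝ, HasDerivAt vb (D x) x) ∧
      (∀ x : ℝ, x ≠ b → HasDerivAt D (E x) x) ∧
      Filter.Tendsto E (nhdsWithin b (Set.Ioi b)) (nhds (C * (q / (r + q)) * φ ^ 2)) ∧
      Filter.Tendsto E (nhdsWithin b (Set.Iio b))
        (nhds (-(r * q / (r + q)) * W0 + C * (q / (r + q)) * φ * (φ - r * W0))) ∧
      C * (q / (r + q)) * φ ^ 2 -
        (-(r * q / (r + q)) * W0 + C * (q / (r + q)) * φ * (φ - r * W0)) =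
        r * q / (r + q) * W0 * (1 + C * φ) ∧
      (C * (q / (r + q)) * φ ^ 2 =
        -(r * q / (r + q)) * W0 + C * (q / (r + q)) * φ * (φ - r * W0) ↔ C = -(1 / φ)) := by
  have hInt := integrable_exp_mul_of_integrableOn_Ioi hWneg hWint
  have hW := continuousOn_compl_zero hWneg hWcont
  have hrq : r + q ≠ 0 := (add_pos hr hq).ne'
  have hsub : ∀ x : ℝ, HasDerivAt (fun x => b - x) (-1) x := fun x => by
    simpa using (hasDerivAt_id x).const_sub b
  have hJlim : Tendsto (fun x => Jfun r φ W (b - x)) (𝓝 b) (𝓝 1) := by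
    have h := ((continuous_Jfun r hInt).comp (continuous_const.sub continuous_id)).tendsto b
      (f := Jfun r φ W ∘ fun x => b - x)
    simpa [Jfun, Function.comp_def] using h
  have hEeq : E = fun x => -(r * q / (r + q)) * W (b - x) +
      C * (q / (r + q)) * (φ ^ 2 * Jfun r φ W (b - x) - r * φ * W (b - x)) := funext hE
  have hElim : ∀ (s : Set ℝ) (w : ℝ), Tendsto (fun x => W (b - x)) (𝓝[s] b) (𝓝 w) →
      Tendsto E (𝓝[s] b) (𝓝 (-(r * q / (r + q)) * w +
        C * (q / (r + q)) * (φ ^ 2 * 1 - r * φ * w))) := fun s w hw => by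
    rw [hEeq]
    exact (hw.const_mul _).add ((((hJlim.mono_left nhdsWithin_le_nhds).const_mul _).sub
      (hw.const_mul _)).const_mul _)
  have hjump : C * (q / (r + q)) * φ ^ 2 -
      (-(r * q / (r + q)) * W0 + C * (q / (r + q)) * φ * (φ - r * W0)) =
      r * q / (r + q) * W0 * (1 + C * φ) := by ring
  refine ⟨fun x => ?_, fun x hx => ?_, ?_, ?_, hjump, ?_⟩
  · rw [funext hvb, funext hH]
    refine ((((hasDerivAt_Zqr q r hInt hW (b - x)).comp x (hsub x)).const_mul C).sub
      ((((hasDerivAt_Zbar q hInt (b - x)).comp x (hsub x)).add_const (m / q)).const_mul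
        (r / (r + q)))).congr_deriv ?_
    rw [hD]
    ring
  · have hy : b - x ≠ 0 := sub_ne_zero.2 hx.symm
    rw [funext hD]
    refine ((((hasDerivAt_Zq q hInt hW hy).comp x (hsub x)).const_mul (r / (r + q))).sub
      (((hasDerivAt_Jfun r hInt hW hy).comp x (hsub x)).const_mul
        (C * (q / (r + q)) * φ))).congr_deriv ?_
    rw [hE]
    ring
  · convert hElim (Ioi b) 0 ?_ using 2
    · ring
    · refine tendsto_const_nhds.congr' ?_
      filter_upwards [self_mem_nhdsWithin] with x hx
      exact (hWneg _ (sub_neg.2 hx)).symm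
  · convert hElim (Iio b) W0 (hW0.comp ?_) using 2
    · ring
    · refine tendsto_nhdsWithin_iff.2 ⟨?_, ?_⟩
      · have h : Tendsto (fun x => b - x) (𝓝 b) (𝓝 (b - b)) := tendsto_const_nhds.sub tendsto_id
        rw [sub_self] at h
        exact h.mono_left nhdsWithin_le_nhds
      · filter_upwards [self_mem_nhdsWithin] with x hx
        exact sub_pos.2 (mem_Iio.1 hx)
  · have hpos : r * q / (r + q) * W0 ≠ 0 := by positivity
    rw [← sub_eq_zero, hjump, mul_eq_zero, or_iff_right hpos, ← neg_div, eq_div_iff hφ.ne']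
    constructor <;> intro h <;> linarith
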